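/- Let f : ℕ → ℤ be strictly increasing with f(0) = −1 and f(x) ≥ x for every integer x ≥ 1, and assume every agent's centrality is degree homophilic with f. Then a network g is an APSN if and only if there exist integers a₁ > a₂ > … > a_p with a_p ≥ 3 (p ≥ 0 cliques) and r ≥ 0 such that g is a disjoint union of complete graphs K_{a₁}, …, K_{a_p} (one component of each size) together with r isolated vertices, and a_t − 1 > f(a_{t+1} − 1) for every t = 1, …, p−1 ('stratified clique graphs': a rich-club sequence of cliques of strictly decreasing sizes, none of size two, plus isolated vertices). -/

import Mathlib

open SimpleGraph

/-- Degree of vertex `i` in network `g`. -/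
noncomputable def deg {V : Type*} (g : SimpleGraph V) (i : V) : ℕ :=
  Nat.card (g.neighborSet i)

/-- The network `g` with the (missing) edge `ij` added. -/
def addE {V : Type*} (g : SimpleGraph V) (i j : V) : SimpleGraph V :=
  g ⊔ SimpleGraph.fromEdgeSet {s(i, j)}

/-- The network `g` with the edge `ij` removed. -/
def delE {V : Type*} (g : SimpleGraph V) (i j : V) : SimpleGraph V :=
  g.deleteEdges {s(i, j)}

/-- Utility of agent `i` in the game with centralities `C` and edge cost `c`. -/
noncomputable def util {V : Type*} (C : V → SimpleGraph V → ℝ) (c : ℝ) (i : V)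
    (g : SimpleGraph V) : ℝ :=
  C i g - c * (deg g i)

/-- Adding the missing edge `ij` is an improving move. -/
def ImprovingAdd {V : Type*} (C : V → SimpleGraph V → ℝ) (c : ℝ) (g : SimpleGraph V)
    (i j : V) : Prop :=
  util C c i (addE g i j) ≥ util C c i g ∧ util C c j (addE g i j) ≥ util C c j g ∧
    (util C c i (addE g i j) > util C c i g ∨ util C c j (addE g i j) > util C c j g)

/-- Deleting the edge `ij` is an improving move. -/
def ImprovingDel {V : Type*} (C : V → SimpleGraph V → ℝ) (c : ℝ) (g : SimpleGraph V)
    (i j : V) : Prop :=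
  util C c i (delE g i j) > util C c i g ∨ util C c j (delE g i j) > util C c j g

/-- `g` is pairwise stable at edge cost `c`. -/
def PairwiseStable {V : Type*} (C : V → SimpleGraph V → ℝ) (c : ℝ) (g : SimpleGraph V) : Prop :=
  (∀ i j : V, i ≠ j → ¬ g.Adj i j → ¬ ImprovingAdd C c g i j) ∧
  (∀ i j : V, g.Adj i j → ¬ ImprovingDel C c g i j)

/-- `g` is asymptotically pairwise stable. -/
def APSN {V : Type*} (C : V → SimpleGraph V → ℝ) (g : SimpleGraph V) : Prop :=
  ∃ ε₀ : ℝ, 0 < ε₀ ∧ ∀ c : ℝ, 0 < c → c < ε₀ → PairwiseStable C c g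

/-- Axiom 1: the centrality of agent `i` is increasing. -/
def Axiom1 {V : Type*} (C : V → SimpleGraph V → ℝ) (i : V) : Prop :=
  ∀ (g : SimpleGraph V) (j : V), j ≠ i → ¬ g.Adj i j → C i (addE g i j) > C i g

/-- Axiom 1′: the centrality of agent `i` is decreasing. -/
def Axiom1' {V : Type*} (C : V → SimpleGraph V → ℝ) (i : V) : Prop :=
  ∀ (g : SimpleGraph V) (j : V), j ≠ i → ¬ g.Adj i j → C i (addE g i j) < C i g

/-- Axiom 2: the centrality of agent `i` is componentwise. -/
def Axiom2 {V : Type*} (C : V → SimpleGraph V → ℝ) (i : V) : Prop :=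
  ∀ (g : SimpleGraph V) (j : V), j ≠ i → ¬ g.Adj i j →
    ((g.Reachable i j → C i (addE g i j) > C i g) ∧
     (¬ g.Reachable i j → C i (addE g i j) ≤ C i g))

/-- Axiom 2′: the centrality of agent `i` is peripheral. -/
def Axiom2' {V : Type*} (C : V → SimpleGraph V → ℝ) (i : V) : Prop :=
  ∀ (g : SimpleGraph V) (j : V), j ≠ i → ¬ g.Adj i j →
    ((g.Reachable i j → C i (addE g i j) ≤ C i g) ∧
     (¬ g.Reachable i j → C i (addE g i j) > C i g))

/-- The centrality of agent `i` is degree homophilic with (strictly increasing) `f`. -/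
def DegreeHomophilic {V : Type*} (C : V → SimpleGraph V → ℝ) (i : V) (f : ℕ → ℤ) : Prop :=
  ∀ (g : SimpleGraph V) (j : V), j ≠ i → ¬ g.Adj i j →
    (C i (addE g i j) > C i g ↔ (deg g j : ℤ) ≤ f (deg g i))

open Filter Topology

section Edges

variable {V : Type*} {g : SimpleGraph V} {i j : V}

lemma addE_comm (g : SimpleGraph V) (i j : V) : addE g i j = addE g j i := by
  simp only [addE, Sym2.eq_swap]

lemma delE_comm (g : SimpleGraph V) (i j : V) : delE g i j = delE g j i := by
  simp only [delE, Sym2.eq_swap]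

lemma addE_delE (h : g.Adj i j) : addE (delE g i j) i j = g := by
  ext x y
  simp only [addE, delE, sup_adj, deleteEdges_adj, fromEdgeSet_adj, Set.mem_singleton_iff]
  constructor
  · rintro (h' | ⟨h', -⟩)
    · exact h'.1
    · rw [← mem_edgeSet, h']
      exact h
  · intro h'
    by_cases hxy : s(x, y) = s(i, j)
    · exact Or.inr ⟨hxy, h'.ne⟩
    · exact Or.inl ⟨h', hxy⟩

lemma not_adj_delE (g : SimpleGraph V) (i j : V) : ¬ (delE g i j).Adj i j := by
  simp [delE]

end Edges

section Degrees

variable {V : Type*} [Finite V] {g : SimpleGraph V} {i j : V}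

lemma deg_pos_of_adj (h : g.Adj i j) : 1 ≤ deg g i :=
  (Set.ncard_pos (Set.toFinite (g.neighborSet i))).2 ⟨j, h⟩

lemma exists_adj_of_deg_pos (h : 1 ≤ deg g i) : ∃ j, g.Adj i j :=
  (Set.ncard_pos (Set.toFinite (g.neighborSet i))).1 h

lemma ncard_insert_neighborSet (g : SimpleGraph V) (v : V) :
    (insert v (g.neighborSet v)).ncard = deg g v + 1 :=
  Set.ncard_insert_of_notMem (by simp)

lemma deg_addE (hij : i ≠ j) (h : ¬ g.Adj i j) : deg (addE g i j) i = deg g i + 1 := by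
  have : (addE g i j).neighborSet i = insert j (g.neighborSet i) := by
    ext x
    simp only [addE, mem_neighborSet, sup_adj, fromEdgeSet_adj, Set.mem_singleton_iff,
      Set.mem_insert_iff, Sym2.congr_right]
    grind
  unfold deg
  rw [this]
  exact Set.ncard_insert_of_notMem h

lemma deg_delE (h : g.Adj i j) : deg (delE g i j) i + 1 = deg g i := by
  conv_rhs => rw [← addE_delE h]
  exact (deg_addE h.ne (not_adj_delE g i j)).symm

/-- When all components are cliques, a component has one more vertex than the degree of any of
its vertices. -/
lemma ncard_supp_of_clique (hclique : ∀ i j : V, g.Reachable i j → i = j ∨ g.Adj i j) (v : V) :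
    Nat.card (g.connectedComponentMk v).supp = deg g v + 1 := by
  rw [← ncard_insert_neighborSet]
  change Set.ncard _ = _
  congr 1
  ext x
  rw [ConnectedComponent.mem_supp_iff, ConnectedComponent.eq, Set.mem_insert_iff,
    mem_neighborSet]
  constructor
  · intro h
    rcases hclique _ _ h with h | h
    · exact Or.inl h
    · exact Or.inr h.symm
  · rintro (rfl | h)
    · exact Reachable.refl _
    · exact h.reachable.symm

end Degrees

section Stability

lemma apsn_iff_eventually {V : Type*} {C : V → SimpleGraph V → ℝ} {g : SimpleGraph V} :
    APSN C g ↔ ∀ᶠ c in 𝓝[>] (0 : ℝ), PairwiseStable C c g := by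
  rw [Filter.Eventually, mem_nhdsGT_iff_exists_Ioo_subset]
  constructor
  · rintro ⟨ε, hε, h⟩
    exact ⟨ε, hε, fun c hc => h c hc.1 hc.2⟩
  · rintro ⟨ε, hε, h⟩
    exact ⟨ε, hε, fun c h0 h1 => h ⟨h0, h1⟩⟩

variable {V : Type*} [Finite V] {C : V → SimpleGraph V → ℝ} {g : SimpleGraph V}

lemma util_addE {i j : V} (hij : i ≠ j) (h : ¬ g.Adj i j) (c : ℝ) :
    util C c i (addE g i j) - util C c i g = C i (addE g i j) - C i g - c := by
  simp only [util, deg_addE hij h]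
  push_cast
  ring

lemma util_delE {i j : V} (h : g.Adj i j) (c : ℝ) :
    util C c i (delE g i j) - util C c i g = c - (C i g - C i (delE g i j)) := by
  simp only [util, ← deg_delE h]
  push_cast
  ring

lemma eventually_not_improvingAdd {i j : V} (hij : i ≠ j) (h : ¬ g.Adj i j) :
    (∀ᶠ c in 𝓝[>] (0 : ℝ), ¬ ImprovingAdd C c g i j) ↔
      ¬ (C i g < C i (addE g i j) ∧ C j g < C j (addE g i j)) := by
  have hi := util_addE (C := C) hij h
  have hj := util_addE (C := C) hij.symm (fun h' => h h'.symm)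
  rw [addE_comm g j i] at hj
  constructor
  · rintro hc ⟨h1, h2⟩
    obtain ⟨c, hc, hc1, hc2⟩ := (hc.and (inter_mem (Ioo_mem_nhdsGT (sub_pos.2 h1))
      (Ioo_mem_nhdsGT (sub_pos.2 h2)))).exists
    have hi := hi c
    have hj := hj c
    have hc1 := hc1.2
    have hc2 := hc2.2
    exact hc ⟨by linarith, by linarith, Or.inl (by linarith)⟩
  · intro hc
    filter_upwards [self_mem_nhdsWithin] with c hc0 himp
    have hc0 : 0 < c := hc0
    have hi := hi c
    have hj := hj c
    have h1 := himp.1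
    have h2 := himp.2.1
    exact hc ⟨by linarith, by linarith⟩

lemma eventually_not_improvingDel {i j : V} (h : g.Adj i j) :
    (∀ᶠ c in 𝓝[>] (0 : ℝ), ¬ ImprovingDel C c g i j) ↔
      C i (delE g i j) < C i g ∧ C j (delE g i j) < C j g := by
  have hi := util_delE (C := C) h
  have hj := util_delE (C := C) h.symm
  rw [delE_comm g j i] at hj
  constructor
  · intro hc
    obtain ⟨c, hc, hc0⟩ := (hc.and self_mem_nhdsWithin).exists
    have hc0 : 0 < c := hc0
    simp only [ImprovingDel, not_or, gt_iff_lt, not_lt] at hc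
    have hi := hi c
    have hj := hj c
    exact ⟨by linarith [hc.1], by linarith [hc.2]⟩
  · rintro ⟨h1, h2⟩
    filter_upwards [Ioo_mem_nhdsGT (sub_pos.2 h1), Ioo_mem_nhdsGT (sub_pos.2 h2)] with c hc1 hc2
    have hi := hi c
    have hj := hj c
    have hc1 := hc1.2
    have hc2 := hc2.2
    rintro (h' | h') <;> linarith

/-- Asymptotic pairwise stability under degree homophily, as a condition on degrees. -/
lemma apsn_iff (f : ℕ → ℤ) (hC : ∀ i, DegreeHomophilic C i f) :
    APSN C g ↔
      (∀ i j, i ≠ j → ¬ g.Adj i j →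
        ¬ ((deg g j : ℤ) ≤ f (deg g i) ∧ (deg g i : ℤ) ≤ f (deg g j))) ∧
      (∀ i j, g.Adj i j → (deg g j : ℤ) - 1 ≤ f (deg g i - 1)) := by
  have hadd : ∀ i j, i ≠ j → ¬ g.Adj i j →
      ((∀ᶠ c in 𝓝[>] (0 : ℝ), ¬ ImprovingAdd C c g i j) ↔
        ¬ ((deg g j : ℤ) ≤ f (deg g i) ∧ (deg g i : ℤ) ≤ f (deg g j))) := by
    intro i j hij h
    rw [eventually_not_improvingAdd hij h, ← hC i g j hij.symm h,
      ← hC j g i hij (fun h' => h h'.symm), addE_comm g j i]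
  have hgain : ∀ i j, g.Adj i j →
      (C i (delE g i j) < C i g ↔ (deg g j : ℤ) - 1 ≤ f (deg g i - 1)) := by
    intro i j h
    have key := hC i (delE g i j) j h.ne' (not_adj_delE g i j)
    have hdi := deg_delE h
    have hdj := deg_delE h.symm
    rw [delE_comm g j i] at hdj
    rw [addE_delE h] at key
    rw [gt_iff_lt] at key
    rw [key, ← hdi, ← hdj, Nat.add_sub_cancel]
    push_cast
    rw [add_sub_cancel_right]
  have hdel : ∀ i j, g.Adj i j →
      ((∀ᶠ c in 𝓝[>] (0 : ℝ), ¬ ImprovingDel C c g i j) ↔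
        ((deg g j : ℤ) - 1 ≤ f (deg g i - 1) ∧ (deg g i : ℤ) - 1 ≤ f (deg g j - 1))) := by
    intro i j h
    rw [eventually_not_improvingDel h, ← hgain i j h, ← hgain j i h.symm, delE_comm g j i]
  rw [apsn_iff_eventually]
  simp only [PairwiseStable, eventually_and, eventually_all]
  refine and_congr ?_ ⟨fun h i j hij => ((hdel i j hij).1 (h i j hij)).1,
    fun h i j hij => (hdel i j hij).2 ⟨h i j hij, h j i hij.symm⟩⟩
  exact forall₄_congr hadd

end Stability

section Strata

variable {V : Type*} [Finite V]

/-- Under the degree conditions, adjacent vertices have the same closed neighborhood. -/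
lemma closed_neighborhood_eq_of_adj (f : ℕ → ℤ) (hf : StrictMono f) (g : SimpleGraph V)
    (hadd : ∀ i j, i ≠ j → ¬ g.Adj i j →
      ¬ ((deg g j : ℤ) ≤ f (deg g i) ∧ (deg g i : ℤ) ≤ f (deg g j)))
    (hdel : ∀ i j, g.Adj i j → (deg g j : ℤ) - 1 ≤ f (deg g i - 1))
    (hfx : ∀ x : ℕ, 1 ≤ x → (x : ℤ) ≤ f x) (k j : V) (hkj : g.Adj k j) :
    insert k (g.neighborSet k) = insert j (g.neighborSet j) := by
  induction h : Nat.card V - deg g k using Nat.strong_induction_on generalizing k j with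
  | _ n ih =>
    have hle : ∀ v, deg g v ≤ Nat.card V := fun v => Set.ncard_le_card (g.neighborSet v)
    have hnb : ∀ j, g.Adj k j → deg g j ≤ deg g k := by
      intro j hkj
      by_contra! hlt
      have := congrArg Set.ncard
        (ih (Nat.card V - deg g j) (by have := hle j; omega) j k hkj.symm rfl)
      rw [ncard_insert_neighborSet, ncard_insert_neighborSet] at this
      omega
    set S : Set V := {v | deg g v ≤ deg g k ∧ (deg g k : ℤ) ≤ f (deg g v)} with hS
    have hsub : insert k (g.neighborSet k) ⊆ S := by
      rintro v (rfl | hv)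
      · exact ⟨le_rfl, hfx _ (deg_pos_of_adj hkj)⟩
      · refine ⟨hnb v hv, ?_⟩
        have h1 := hdel v k hv.symm
        have h2 := deg_pos_of_adj (Adj.symm hv)
        have h3 : f (deg g v - 1) < f (deg g v) := hf (by omega)
        omega
    have hS_sub : ∀ v ∈ S, S ⊆ insert v (g.neighborSet v) := by
      intro v hv w hw
      by_contra hn
      simp only [Set.mem_insert_iff, mem_neighborSet, not_or] at hn
      have h1 : (deg g v : ℤ) ≤ deg g k := by exact_mod_cast hv.1
      have h2 : (deg g w : ℤ) ≤ deg g k := by exact_mod_cast hw.1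
      exact hadd v w (Ne.symm hn.1) hn.2 ⟨h2.trans hv.2, h1.trans hw.2⟩
    have hj : j ∈ S := hsub (Or.inr hkj)
    refine Set.eq_of_subset_of_ncard_le (hsub.trans (hS_sub j hj)) ?_ (Set.toFinite _)
    rw [ncard_insert_neighborSet, ncard_insert_neighborSet]
    exact Nat.succ_le_succ hj.1

/-- The degree conditions force a stratified clique graph. -/
lemma exists_strata_of_degree_conditions (f : ℕ → ℤ) (hf : StrictMono f) (hf0 : f 0 = -1)
    (hfx : ∀ x : ℕ, 1 ≤ x → (x : ℤ) ≤ f x) (g : SimpleGraph V)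
    (hadd : ∀ i j, i ≠ j → ¬ g.Adj i j →
      ¬ ((deg g j : ℤ) ≤ f (deg g i) ∧ (deg g i : ℤ) ≤ f (deg g j)))
    (hdel : ∀ i j, g.Adj i j → (deg g j : ℤ) - 1 ≤ f (deg g i - 1)) :
    ∃ (p : ℕ) (a : Fin p → ℕ) (e : Fin p → g.ConnectedComponent),
      StrictAnti a ∧ (∀ t, 3 ≤ a t) ∧
      (∀ (t : Fin p) (ht : (t : ℕ) + 1 < p),
        (a t : ℤ) - 1 > f (a ⟨(t : ℕ) + 1, ht⟩ - 1)) ∧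
      Function.Injective e ∧
      (∀ t, Nat.card ((e t).supp) = a t) ∧
      (∀ c : g.ConnectedComponent, 2 ≤ Nat.card c.supp → ∃ t, e t = c) ∧
      (∀ i j : V, g.Reachable i j → i = j ∨ g.Adj i j) := by
  classical
  have hclique : ∀ i j : V, g.Reachable i j → i = j ∨ g.Adj i j := by
    rintro i j ⟨w⟩
    induction w with
    | nil => exact Or.inl rfl
    | @cons u v w huv _ ih =>
      have hmem : w ∈ insert v (g.neighborSet v) := by
        rcases ih with rfl | h
        · exact Or.inl rfl
        · exact Or.inr h
      rw [← closed_neighborhood_eq_of_adj f hf g hadd hdel hfx u v huv] at hmem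
      rcases hmem with rfl | h
      · exact Or.inl rfl
      · exact Or.inr h
  have hsize := ncard_supp_of_clique hclique
  have hgap : ∀ c d : g.ConnectedComponent, c ≠ d → 2 ≤ Nat.card c.supp →
      Nat.card c.supp ≤ Nat.card d.supp →
      f (Nat.card c.supp - 1) < (Nat.card d.supp : ℤ) - 1 := by
    intro c d
    induction c using ConnectedComponent.ind with | _ v
    induction d using ConnectedComponent.ind with | _ w
    rw [hsize, hsize]
    intro hne h2 hle
    have hnr : ¬ g.Reachable v w := fun h => hne (ConnectedComponent.eq.2 h)
    have hvw := hadd v w (fun h => hnr (h ▸ Reachable.refl _)) (fun h => hnr h.reachable)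
    have hw := hfx (deg g w) (by omega)
    by_contra! hcon
    simp only [Nat.add_sub_cancel] at hcon
    push_cast at hcon
    exact hvw ⟨by omega, by omega⟩
  have hcard_inj : ∀ c d : g.ConnectedComponent, 2 ≤ Nat.card c.supp →
      Nat.card c.supp = Nat.card d.supp → c = d := by
    intro c d h2 heq
    by_contra hne
    have h1 := hgap c d hne h2 heq.le
    have h2 := hfx (Nat.card c.supp - 1) (by omega)
    omega
  have hthree : ∀ c : g.ConnectedComponent, 2 ≤ Nat.card c.supp → 3 ≤ Nat.card c.supp := by
    intro c
    induction c using ConnectedComponent.ind with | _ v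
    rw [hsize]
    intro h2
    obtain ⟨w, hw⟩ := exists_adj_of_deg_pos (g := g) (i := v) (by omega)
    have h1 := hdel v w hw
    by_contra! h3
    have hv : deg g v - 1 = 0 := by omega
    have hwpos := deg_pos_of_adj hw.symm
    rw [hv, hf0] at h1
    omega
  have hfin : {n | ∃ c : g.ConnectedComponent, 2 ≤ Nat.card c.supp ∧ Nat.card c.supp = n}.Finite :=
    (Set.finite_range fun c : g.ConnectedComponent => Nat.card c.supp).subset
      (by rintro n ⟨c, -, rfl⟩; exact ⟨c, rfl⟩)
  set T := hfin.toFinset with hT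
  let a : Fin T.card → ℕ := fun t => T.orderEmbOfFin rfl t.rev
  have ha : StrictAnti a := fun s t hst =>
    (T.orderEmbOfFin rfl).strictMono (Fin.rev_lt_rev.2 hst)
  have hex : ∀ t, ∃ c : g.ConnectedComponent, 2 ≤ Nat.card c.supp ∧ Nat.card c.supp = a t :=
    fun t => hfin.mem_toFinset.1 (T.orderEmbOfFin_mem rfl t.rev)
  choose e he2 hea using hex
  have he : Function.Injective e := by
    intro s t hst
    apply ha.injective
    rw [← hea s, ← hea t, hst]
  refine ⟨T.card, a, e, ha, fun t => hea t ▸ hthree _ (he2 t), fun t ht => ?_, he, hea,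
    fun c hc => ?_, hclique⟩
  · have hlt : t < ⟨(t : ℕ) + 1, ht⟩ := Fin.lt_def.2 (Nat.lt_succ_self _)
    rw [← hea t, ← hea ⟨(t : ℕ) + 1, ht⟩]
    refine hgap _ _ (fun h => hlt.ne' (he h)) (he2 _) ?_
    rw [hea, hea]
    exact (ha hlt).le
  · have hmem : Nat.card c.supp ∈ T := hfin.mem_toFinset.2 ⟨c, hc, rfl⟩
    rw [← Finset.mem_coe, ← T.range_orderEmbOfFin rfl] at hmem
    obtain ⟨s, hs⟩ := hmem
    refine ⟨s.rev, hcard_inj _ _ (he2 _) ?_⟩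
    rw [hea, ← hs]
    simp [a]

end Strata

theorem statement_6 {V : Type*} [Fintype V] (C : V → SimpleGraph V → ℝ) (f : ℕ → ℤ)
    (hf : StrictMono f) (hf0 : f 0 = -1) (hfx : ∀ x : ℕ, 1 ≤ x → (x : ℤ) ≤ f x)
    (hC : ∀ i, DegreeHomophilic C i f) (g : SimpleGraph V) :
    APSN C g ↔
      -- `g` is a disjoint union of cliques `K_{a 0}, …, K_{a (p-1)}` of strictly
      -- decreasing sizes `≥ 3`, one component of each size, together with isolated
      -- vertices, and consecutive sizes satisfy the gap condition.
      ∃ (p : ℕ) (a : Fin p → ℕ) (e : Fin p → g.ConnectedComponent),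
        StrictAnti a ∧ (∀ t, 3 ≤ a t) ∧
        (∀ (t : Fin p) (ht : (t : ℕ) + 1 < p),
          (a t : ℤ) - 1 > f (a ⟨(t : ℕ) + 1, ht⟩ - 1)) ∧
        Function.Injective e ∧
        (∀ t, Nat.card ((e t).supp) = a t) ∧
        (∀ c : g.ConnectedComponent, 2 ≤ Nat.card c.supp → ∃ t, e t = c) ∧
        (∀ i j : V, g.Reachable i j → i = j ∨ g.Adj i j) := by
  rw [apsn_iff f hC]
  constructor
  · rintro ⟨hadd, hdel⟩
    exact exists_strata_of_degree_conditions f hf hf0 hfx g hadd hdel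
  · rintro ⟨p, a, e, ha, ha3, hgap, he, hcard, hsurj, hclique⟩
    have hdeg : ∀ v w, g.Adj v w → ∃ t, e t = g.connectedComponentMk v ∧ a t = deg g v + 1 := by
      intro v w hvw
      have hs := ncard_supp_of_clique hclique v
      obtain ⟨t, ht⟩ := hsurj (g.connectedComponentMk v) (by
        have := deg_pos_of_adj hvw
        omega)
      exact ⟨t, ht, by rw [← hcard t, ht, hs]⟩
    have hlt : ∀ s t : Fin p, s < t → f (a t - 1) < (a s : ℤ) - 1 := by
      intro s t hst
      have hst' : (s : ℕ) < t := hst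
      have htp := t.isLt
      have h1 := hgap ⟨t - 1, by omega⟩ (by simp only; omega)
      have h2 : (⟨((⟨t - 1, by omega⟩ : Fin p) : ℕ) + 1, by simp only; omega⟩ : Fin p) = t := by
        ext
        simp only
        omega
      rw [h2] at h1
      have h3 : a ⟨t - 1, by omega⟩ ≤ a s := ha.antitone (by
        rw [Fin.le_def]
        simp only
        omega)
      omega
    refine ⟨fun i j hij hn hji => ?_, fun i j hij => ?_⟩
    · have hpos : ∀ v w, (deg g v : ℤ) ≤ f (deg g w) → ∃ x, g.Adj w x := by
        intro v w h
        apply exists_adj_of_deg_pos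
        by_contra! h0
        have : deg g w = 0 := by omega
        rw [this, hf0] at h
        omega
      obtain ⟨x, hx⟩ := hpos _ _ hji.1
      obtain ⟨y, hy⟩ := hpos _ _ hji.2
      obtain ⟨s, hs, has⟩ := hdeg i x hx
      obtain ⟨t, ht, hat⟩ := hdeg j y hy
      rcases lt_trichotomy s t with h | h | h
      · have := hlt s t h
        rw [has, hat, Nat.add_sub_cancel] at this
        push_cast at this
        omega
      · have hr : g.Reachable i j := by
          rw [← ConnectedComponent.eq, ← hs, ← ht, h]
        rcases hclique i j hr with h | h
        · exact hij h
        · exact hn h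
      · have := hlt t s h
        rw [has, hat, Nat.add_sub_cancel] at this
        push_cast at this
        omega
    · obtain ⟨s, hs, has⟩ := hdeg i j hij
      obtain ⟨t, ht, hat⟩ := hdeg j i hij.symm
      have hst : s = t := he (by rw [hs, ht, ConnectedComponent.eq]; exact hij.reachable)
      subst hst
      have h3 := ha3 s
      have hd : deg g j = deg g i := by omega
      have := hfx (deg g i - 1) (by omega)
      rw [hd]
      omega
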